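/- Let C be a natural number, X a real C×C matrix, v̂ ∈ ℝ^C, M ≥ 0 with M·‖X‖ < 1, let 0 < ε ≤ 1, and let φ_n : ℝ → ℝ (n = 1,…,C) each be Lipschitz with constant M. Define f : ℝ^C → ℝ^C by f(q) = (1−ε)·q + ε·Φ(X·q + v̂), where Φ(u)_n = φ_n(u_n). Then f is Lipschitz with constant (1−ε) + ε·M·‖X‖ < 1; consequently f has a unique fixed point q*, and for every initial point q(0) the iterates q(t+1) = f(q(t)) converge to q* as t → ∞. -/

import Mathlib

/-- Componentwise domination by a multiple passes to the Euclidean norm. -/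
theorem EuclideanSpace.norm_le_mul_norm_of_abs_apply_le {ι : Type*} [Fintype ι] {c : ℝ}
    (hc : 0 ≤ c) {u w : EuclideanSpace ℝ ι} (h : ∀ i, |u i| ≤ c * |w i|) :
    ‖u‖ ≤ c * ‖w‖ := by
  refine (sq_le_sq₀ (norm_nonneg _) (by positivity)).1 ?_
  rw [mul_pow, EuclideanSpace.norm_sq_eq, EuclideanSpace.norm_sq_eq, Finset.mul_sum]
  refine Finset.sum_le_sum fun i _ => ?_
  rw [← mul_pow, Real.norm_eq_abs, Real.norm_eq_abs]
  exact pow_le_pow_left₀ (abs_nonneg _) (h i) 2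

/-- The incremental rule `f(q) = (1 - ε) • q + ε • Φ(X q + v̂)` (with `Φ` acting
componentwise via `M`-Lipschitz functions `φ n`, `0 < ε ≤ 1`, `M * ‖X‖ < 1`) is
Lipschitz with constant `(1 - ε) + ε * M * ‖X‖ < 1`; consequently it has a unique
fixed point `q*` and the iterates converge to `q*` from any initial point. -/
theorem incremental_contraction_convergence (C : ℕ) (X : Matrix (Fin C) (Fin C) ℝ)
    (vhat : Fin C → ℝ) (M : ℝ) (hM : 0 ≤ M)
    (hMX : M * ‖Matrix.toEuclideanCLM (𝕜 := ℝ) X‖ < 1)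
    (ε : ℝ) (hε0 : 0 < ε) (hε1 : ε ≤ 1)
    (φ : Fin C → ℝ → ℝ)
    (hφ : ∀ n, ∀ x y : ℝ, |φ n x - φ n y| ≤ M * |x - y|)
    (f : EuclideanSpace ℝ (Fin C) → EuclideanSpace ℝ (Fin C))
    (hf : ∀ q, ∀ n, f q n = (1 - ε) * q n + ε * φ n ((X.mulVec q + vhat) n)) :
    (∀ p q : EuclideanSpace ℝ (Fin C),
      dist (f p) (f q) ≤ ((1 - ε) + ε * M * ‖Matrix.toEuclideanCLM (𝕜 := ℝ) X‖) * dist p q) ∧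
    (1 - ε) + ε * M * ‖Matrix.toEuclideanCLM (𝕜 := ℝ) X‖ < 1 ∧
    ∃ qstar : EuclideanSpace ℝ (Fin C),
      f qstar = qstar ∧ (∀ q, f q = q → q = qstar) ∧
      ∀ q0 : EuclideanSpace ℝ (Fin C),
        Filter.Tendsto (fun t : ℕ => f^[t] q0) Filter.atTop (nhds qstar) := by
  set L := ‖Matrix.toEuclideanCLM (𝕜 := ℝ) X‖
  have hL0 : 0 ≤ L := norm_nonneg _
  have hlip : ∀ p q, dist (f p) (f q) ≤ ((1 - ε) + ε * M * L) * dist p q := by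
    intro p q
    have hd : ‖f p - f q - (1 - ε) • (p - q)‖
        ≤ ε * M * ‖Matrix.toEuclideanCLM (𝕜 := ℝ) X (p - q)‖ := by
      refine EuclideanSpace.norm_le_mul_norm_of_abs_apply_le (by positivity) fun n => ?_
      have hu : (f p - f q - (1 - ε) • (p - q)) n
          = ε * (φ n ((X.mulVec p + vhat) n) - φ n ((X.mulVec q + vhat) n)) := by
        simp only [PiLp.sub_apply, PiLp.smul_apply, smul_eq_mul, hf]
        ring
      have hw : (Matrix.toEuclideanCLM (𝕜 := ℝ) X (p - q)) n
          = (X.mulVec p + vhat) n - (X.mulVec q + vhat) n := by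
        simp
      rw [hu, hw, abs_mul, abs_of_pos hε0, mul_assoc]
      exact mul_le_mul_of_nonneg_left (hφ n _ _) hε0.le
    have hX : ‖Matrix.toEuclideanCLM (𝕜 := ℝ) X (p - q)‖ ≤ L * ‖p - q‖ :=
      ContinuousLinearMap.le_opNorm _ _
    rw [dist_eq_norm, dist_eq_norm]
    calc ‖f p - f q‖ = ‖(f p - f q - (1 - ε) • (p - q)) + (1 - ε) • (p - q)‖ := by
          rw [sub_add_cancel]
      _ ≤ ‖f p - f q - (1 - ε) • (p - q)‖ + ‖(1 - ε) • (p - q)‖ := norm_add_le _ _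
      _ ≤ ε * M * (L * ‖p - q‖) + (1 - ε) * ‖p - q‖ := by
          rw [norm_smul, Real.norm_of_nonneg (sub_nonneg.2 hε1)]
          gcongr
          exact hd.trans (by gcongr)
      _ = ((1 - ε) + ε * M * L) * ‖p - q‖ := by ring
  have hlt : (1 - ε) + ε * M * L < 1 := by nlinarith
  have hK0 : 0 ≤ (1 - ε) + ε * M * L := add_nonneg (sub_nonneg.2 hε1) (by positivity)
  have hc : ContractingWith ⟨(1 - ε) + ε * M * L, hK0⟩ f :=
    ⟨hlt, LipschitzWith.of_dist_le_mul hlip⟩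
  exact ⟨hlip, hlt, hc.fixedPoint f, hc.fixedPoint_isFixedPt,
    fun q hq => hc.fixedPoint_unique hq, hc.tendsto_iterate_fixedPoint⟩
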